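/- Fix integers k ≥ 1 and n > k. Then the following four quantities are equal: inf over all m ≥ 1 and type distributions G over m types for n agents of innerLP^{ST/Proph}_{k,n}(G); the same infimum of innerLP^{ST/ExAnte}_{k,n}(G); the infimum over m, G of sup_{J∈{1,...,m}, ρ∈(0,1]} innerLP^{OST(J,ρ)/Proph}_{k,n}(G); and the infimum over m, G of sup_{J,ρ} innerLP^{OST(J,ρ)/ExAnte}_{k,n}(G). -/

import Mathlib

open Finset

/-- The polytope `P(k,n)` of state/acceptance probability vectors. -/
def memP (k n : ℕ) (x y : ℕ → ℕ → ℝ) : Prop :=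
  x 1 k = 1 ∧
  (∀ l, 1 ≤ l → l < k → x 1 l = 0) ∧
  (∀ i ∈ Finset.Icc 2 n, ∀ l ∈ Finset.Icc 1 k,
    x i l = x (i-1) l - y (i-1) l + (if l < k then y (i-1) (l+1) else 0)) ∧
  (∀ i ∈ Finset.Icc 1 n, ∀ l ∈ Finset.Icc 1 k, 0 ≤ y i l ∧ y i l ≤ x i l)

/-- `G` is a valid family of type distributions over `m` types for `n` agents. -/
def IsTypeDist (n m : ℕ) (G : ℕ → ℕ → ℝ) : Prop :=
  ∀ i ∈ Finset.Icc 1 n, G i 0 = 0 ∧ G i m = 1 ∧ ∀ j ∈ Finset.Icc 1 m, G i (j-1) ≤ G i j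

/-- `E[min{X_1+...+X_t, k}]` for independent Bernoulli `X_i` with success probabilities `p i`. -/
noncomputable def eMinBer (p : ℕ → ℝ) (t k : ℕ) : ℝ :=
  ∑ S ∈ (Finset.Icc 1 t).powerset,
    (∏ i ∈ S, p i) * (∏ i ∈ Finset.Icc 1 t \ S, (1 - p i)) * min (S.card : ℝ) (k : ℝ)

/-- `P(X_1+...+X_t < k)` for independent Bernoulli `X_i` with success probabilities `p i`. -/
noncomputable def probLt (p : ℕ → ℝ) (t k : ℕ) : ℝ :=
  ∑ S ∈ (Finset.Icc 1 t).powerset.filter (fun S => S.card < k),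
    (∏ i ∈ S, p i) * ∏ i ∈ Finset.Icc 1 t \ S, (1 - p i)

noncomputable def QProph (k n : ℕ) (G : ℕ → ℕ → ℝ) (j : ℕ) : ℝ :=
  eMinBer (fun i => G i j) n k

noncomputable def QExAnte (k n : ℕ) (G : ℕ → ℕ → ℝ) (j : ℕ) : ℝ :=
  min (∑ i ∈ Finset.Icc 1 n, G i j) (k : ℝ)

noncomputable def coverSum (k n : ℕ) (G : ℕ → ℕ → ℝ) (j : ℕ) (x y : ℕ → ℕ → ℝ) : ℝ :=
  ∑ i ∈ Finset.Icc 1 n, ∑ l ∈ Finset.Icc 1 k, min (y i l) (G i j * x i l)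

/-- `τ_i(J,ρ)`. -/
noncomputable def tauOf (G : ℕ → ℕ → ℝ) (J : ℕ) (ρ : ℝ) (i : ℕ) : ℝ :=
  (1 - ρ) * G i (J-1) + ρ * G i J

/-- The simplified dual LP `innerLP^{OST(J,ρ)/·}_{k,n}(G)` with coefficients `Q`. -/
noncomputable def innerLP_OST (k n m : ℕ) (G : ℕ → ℕ → ℝ) (J : ℕ) (ρ : ℝ) (Q : ℕ → ℝ) : ℝ :=
  sSup {θ : ℝ | ∃ x y, memP k n x y ∧
    (∀ i ∈ Finset.Icc 1 n, ∀ l ∈ Finset.Icc 1 k, y i l = tauOf G J ρ i * x i l) ∧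
    ∀ j ∈ Finset.Icc 1 m, θ * Q j ≤ coverSum k n G j x y}

open MeasureTheory

/-- The dual problem `innerLP^{ST/·}_{k,n}(G)` with coefficients `Q`: the supremum of `θ` over
all probability measures `μ` on `{1,...,m} × (0,1]` and all families of feasible static
threshold solutions `(x(J,ρ), y(J,ρ)) ∈ P(k,n)` such that the averaged coverage dominates
`θ·Q j` for every type `j`. -/
noncomputable def innerLP_ST (k n m : ℕ) (G : ℕ → ℕ → ℝ) (Q : ℕ → ℝ) : ℝ :=
  sSup {θ : ℝ | ∃ (μ : Measure (ℕ × ℝ)) (x y : ℕ → ℝ → ℕ → ℕ → ℝ),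
    IsProbabilityMeasure μ ∧
    μ ((Set.Icc 1 m ×ˢ Set.Ioc (0:ℝ) 1)ᶜ) = 0 ∧
    (∀ J ∈ Finset.Icc 1 m, ∀ ρ ∈ Set.Ioc (0:ℝ) 1,
      memP k n (x J ρ) (y J ρ) ∧
      ∀ i ∈ Finset.Icc 1 n, ∀ l ∈ Finset.Icc 1 k,
        y J ρ i l = tauOf G J ρ i * x J ρ i l) ∧
    ∀ j ∈ Finset.Icc 1 m,
      θ * Q j ≤ ∫ Jρ : ℕ × ℝ, coverSum k n G j (x Jρ.1 Jρ.2) (y Jρ.1 Jρ.2) ∂μ}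

/-- Expectation of `f` of the number of successes among the agents in `S`. -/
noncomputable def Ef (S : Finset ℕ) (p : ℕ → ℝ) (f : ℕ → ℝ) : ℝ :=
  ∑ A ∈ S.powerset, (∏ i ∈ A, p i) * (∏ i ∈ S \ A, (1 - p i)) * f A.card

lemma Ef_empty (p f : ℕ → ℝ) : Ef ∅ p f = f 0 := by simp [Ef]

lemma Ef_insert {i : ℕ} {S : Finset ℕ} (hi : i ∉ S) (p f : ℕ → ℝ) :
    Ef (insert i S) p f = (1 - p i) * Ef S p f + p i * Ef S p (fun a => f (a + 1)) := by
  unfold Ef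
  rw [Finset.sum_powerset_insert hi, Finset.mul_sum, Finset.mul_sum]
  congr 1
  · refine Finset.sum_congr rfl fun A hA => ?_
    rw [Finset.mem_powerset] at hA
    have hiA : i ∉ A := fun h => hi (hA h)
    rw [Finset.insert_sdiff_of_notMem _ hiA, Finset.prod_insert (by simp [hi])]
    ring
  · refine Finset.sum_congr rfl fun A hA => ?_
    rw [Finset.mem_powerset] at hA
    have hiA : i ∉ A := fun h => hi (hA h)
    rw [Finset.prod_insert hiA, Finset.card_insert_of_notMem hiA]
    have : insert i S \ insert i A = S \ A := by
      ext x; simp only [Finset.mem_sdiff, Finset.mem_insert]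
      constructor
      · rintro ⟨h1, h2⟩; tauto
      · rintro ⟨h1, h2⟩
        refine ⟨Or.inr h1, ?_⟩
        rintro (rfl | h)
        · exact hi h1
        · exact h2 h
    rw [this]; ring

lemma Ef_congr {S : Finset ℕ} {p q : ℕ → ℝ} (h : ∀ i ∈ S, p i = q i) (f : ℕ → ℝ) :
    Ef S p f = Ef S q f := by
  unfold Ef
  refine Finset.sum_congr rfl fun A hA => ?_
  rw [Finset.mem_powerset] at hA
  rw [Finset.prod_congr rfl fun i hi => h i (hA hi),
    Finset.prod_congr rfl fun i hi => congrArg (fun z => 1 - z) (h i (Finset.sdiff_subset hi))]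

lemma Ef_add (S : Finset ℕ) (p f g : ℕ → ℝ) :
    Ef S p (fun a => f a + g a) = Ef S p f + Ef S p g := by
  unfold Ef
  rw [← Finset.sum_add_distrib]
  exact Finset.sum_congr rfl fun A _ => by ring

lemma Ef_sum {ι : Type*} (L : Finset ι) (S : Finset ℕ) (p : ℕ → ℝ) (f : ι → ℕ → ℝ) :
    Ef S p (fun a => ∑ l ∈ L, f l a) = ∑ l ∈ L, Ef S p (f l) := by
  unfold Ef
  rw [Finset.sum_comm]
  exact Finset.sum_congr rfl fun A _ => by rw [Finset.mul_sum]

lemma Ef_const (S : Finset ℕ) (p : ℕ → ℝ) (c : ℝ) : Ef S p (fun _ => c) = c := by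
  induction S using Finset.induction_on with
  | empty => simp [Ef_empty]
  | insert i S hi ih => rw [Ef_insert hi, ih]; ring

lemma Ef_one (S : Finset ℕ) (p f : ℕ → ℝ) (h : ∀ i ∈ S, p i = 1) : Ef S p f = f S.card := by
  induction S using Finset.induction_on generalizing f with
  | empty => simp [Ef_empty]
  | insert i S hi ih =>
    rw [Ef_insert hi, ih _ fun j hj => h j (Finset.mem_insert_of_mem hj),
      ih _ fun j hj => h j (Finset.mem_insert_of_mem hj), h i (Finset.mem_insert_self _ _),
      Finset.card_insert_of_notMem hi]
    ring

lemma Ef_zero (S : Finset ℕ) (p f : ℕ → ℝ) (h : ∀ i ∈ S, p i = 0) : Ef S p f = f 0 := by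
  induction S using Finset.induction_on generalizing f with
  | empty => simp [Ef_empty]
  | insert i S hi ih =>
    rw [Ef_insert hi, ih _ fun j hj => h j (Finset.mem_insert_of_mem hj),
      h i (Finset.mem_insert_self _ _)]
    ring

lemma Ef_mono {S : Finset ℕ} {p f g : ℕ → ℝ} (hp : ∀ i ∈ S, 0 ≤ p i ∧ p i ≤ 1)
    (h : ∀ a, f a ≤ g a) : Ef S p f ≤ Ef S p g := by
  unfold Ef
  refine Finset.sum_le_sum fun A hA => ?_
  rw [Finset.mem_powerset] at hA
  refine mul_le_mul_of_nonneg_left (h _) (mul_nonneg ?_ ?_)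
  · exact Finset.prod_nonneg fun i hi => (hp i (hA hi)).1
  · exact Finset.prod_nonneg fun i hi => by
      have := (hp i (Finset.sdiff_subset hi)).2; linarith

/-- With constant success probabilities only the number of agents matters. -/
lemma Ef_card {S T : Finset ℕ} (h : S.card = T.card) (r : ℝ) (f : ℕ → ℝ) :
    Ef S (fun _ => r) f = Ef T (fun _ => r) f := by
  have key : ∀ U : Finset ℕ, Ef U (fun _ => r) f =
      ∑ A ∈ U.powerset, (fun c => r ^ c * (1 - r) ^ (U.card - c) * f c) A.card := by
    intro U
    unfold Ef
    refine Finset.sum_congr rfl fun A hA => ?_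
    rw [Finset.mem_powerset] at hA
    simp [Finset.card_sdiff_of_subset hA]
  rw [key, key]
  refine (Finset.sum_powerset_apply_card
    (fun c => r ^ c * (1 - r) ^ (S.card - c) * f c)).trans ?_
  refine Eq.trans ?_ (Finset.sum_powerset_apply_card
    (fun c => r ^ c * (1 - r) ^ (T.card - c) * f c)).symm
  rw [h]

/-- Continuity in the success probabilities. -/
lemma Ef_continuous (S : Finset ℕ) (p : ℝ → ℕ → ℝ) (hp : ∀ i, Continuous fun t => p t i)
    (f : ℕ → ℝ) : Continuous fun t => Ef S (p t) f := by
  unfold Ef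
  refine continuous_finsetSum _ fun A _ => ?_
  refine Continuous.mul (Continuous.mul ?_ ?_) continuous_const
  · exact continuous_finsetProd _ fun i _ => hp i
  · exact continuous_finsetProd _ fun i _ => continuous_const.sub (hp i)

/-- `P(number of successes < j)`. -/
noncomputable def cS (S : Finset ℕ) (p : ℕ → ℝ) (j : ℕ) : ℝ :=
  Ef S p (fun a => if a < j then 1 else 0)

/-- `E[min(number of successes, k)]`. -/
noncomputable def eS (S : Finset ℕ) (p : ℕ → ℝ) (k : ℕ) : ℝ :=
  Ef S p (fun a => min (a : ℝ) (k : ℝ))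

lemma cS_insert {i : ℕ} {S : Finset ℕ} (hi : i ∉ S) (p : ℕ → ℝ) (j : ℕ) :
    cS (insert i S) p j = (1 - p i) * cS S p j + p i * cS S p (j - 1) := by
  unfold cS
  rw [Ef_insert hi]
  congr 3
  funext a
  have : a + 1 < j ↔ a < j - 1 := by omega
  simp [this]

lemma eS_insert {i : ℕ} {S : Finset ℕ} (hi : i ∉ S) (p : ℕ → ℝ) (k : ℕ) :
    eS (insert i S) p k = eS S p k + p i * cS S p k := by
  unfold eS cS
  rw [Ef_insert hi]
  have : (fun a : ℕ => min (((a + 1 : ℕ)) : ℝ) (k : ℝ)) =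
      fun a : ℕ => min (a : ℝ) (k : ℝ) + (if a < k then 1 else 0) := by
    funext a
    split_ifs with h
    · have h1 : ((a + 1 : ℕ) : ℝ) ≤ k := by exact_mod_cast h
      have h2 : (a : ℝ) ≤ k := by exact_mod_cast h.le
      rw [min_eq_left h1, min_eq_left h2]; push_cast; ring
    · have h2 : (k : ℝ) ≤ a := by exact_mod_cast not_lt.mp h
      rw [min_eq_right h2, min_eq_right (by push_cast; linarith)]; ring
  rw [this, Ef_add]
  ring

lemma cS_nonneg {S : Finset ℕ} {p : ℕ → ℝ} (hp : ∀ i ∈ S, 0 ≤ p i ∧ p i ≤ 1) (j : ℕ) :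
    0 ≤ cS S p j := by
  have := Ef_mono (f := fun _ => 0) (g := fun a => if a < j then 1 else 0) hp
    (fun a => by split_ifs <;> norm_num)
  rwa [Ef_const] at this

lemma cS_le_one {S : Finset ℕ} {p : ℕ → ℝ} (hp : ∀ i ∈ S, 0 ≤ p i ∧ p i ≤ 1) (j : ℕ) :
    cS S p j ≤ 1 := by
  have := Ef_mono (g := fun _ => 1) (f := fun a => if a < j then 1 else 0) hp
    (fun a => by split_ifs <;> norm_num)
  rwa [Ef_const] at this

lemma cS_mono {S : Finset ℕ} {p : ℕ → ℝ} (hp : ∀ i ∈ S, 0 ≤ p i ∧ p i ≤ 1) {i j : ℕ}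
    (h : i ≤ j) : cS S p i ≤ cS S p j := by
  refine Ef_mono hp fun a => ?_
  split_ifs <;> first | omega | norm_num

lemma eS_le {S : Finset ℕ} {p : ℕ → ℝ} (hp : ∀ i ∈ S, 0 ≤ p i ∧ p i ≤ 1) (k : ℕ) :
    eS S p k ≤ k := by
  have := Ef_mono (g := fun _ => (k : ℝ)) (f := fun a => min (a : ℝ) (k : ℝ)) hp
    (fun a => min_le_right _ _)
  rwa [Ef_const] at this

lemma cS_pos {S : Finset ℕ} {p : ℕ → ℝ} (hp : ∀ i ∈ S, 0 ≤ p i ∧ p i < 1) {j : ℕ}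
    (hj : 1 ≤ j) : 0 < cS S p j := by
  induction S using Finset.induction_on with
  | empty => simp only [cS, Ef_empty]; rw [if_pos (by omega)]; norm_num
  | insert i S hi ih =>
    rw [cS_insert hi]
    have h1 := ih fun j hj => hp j (Finset.mem_insert_of_mem hj)
    have h2 := cS_nonneg (S := S) (p := p)
      (fun j hj => ⟨(hp j (Finset.mem_insert_of_mem hj)).1,
        (hp j (Finset.mem_insert_of_mem hj)).2.le⟩) (j - 1)
    have h3 := hp i (Finset.mem_insert_self _ _)
    have : 0 < (1 - p i) * cS S p j := mul_pos (by linarith) h1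
    have := mul_nonneg h3.1 h2
    linarith

/-- Log-concavity of the distribution function. -/
lemma cS_logconcave {S : Finset ℕ} {p : ℕ → ℝ} (hp : ∀ i ∈ S, 0 ≤ p i ∧ p i ≤ 1) (j : ℕ) :
    cS S p (j - 1 - 1) * cS S p j ≤ cS S p (j - 1) ^ 2 := by
  induction S using Finset.induction_on generalizing j with
  | empty =>
    simp only [cS, Ef_empty]
    split_ifs <;> first | omega | norm_num
  | insert i S hi ih =>
    have hp' : ∀ i ∈ S, 0 ≤ p i ∧ p i ≤ 1 := fun j hj => hp j (Finset.mem_insert_of_mem hj)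
    have ih' := ih hp'
    have h3 := hp i (Finset.mem_insert_self _ _)
    rw [cS_insert hi, cS_insert hi, cS_insert hi]
    have e1 := ih' j
    have e2 := ih' (j - 1)
    have m1 : cS S p (j - 1 - 1 - 1) ≤ cS S p (j - 1 - 1) := cS_mono hp' (by omega)
    have m2 : cS S p (j - 1 - 1) ≤ cS S p (j - 1) := cS_mono hp' (by omega)
    have n0 := cS_nonneg hp' (j - 1 - 1 - 1)
    have n1 := cS_nonneg hp' (j - 1 - 1)
    have n2 := cS_nonneg hp' (j - 1)
    have n3 := cS_nonneg hp' j
    generalize cS S p (j - 1 - 1 - 1) = c0 at *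
    generalize cS S p (j - 1 - 1) = c1 at *
    generalize cS S p (j - 1) = c2 at *
    generalize cS S p j = c3 at *
    have key : c0 * c3 ≤ c1 * c2 := by
      rcases n1.eq_or_lt with h | h
      · have : c0 = 0 := by linarith
        rw [this, ← h]; simp
      · have h2 : 0 < c2 := by linarith
        have : (c0 * c3) * (c1 * c2) ≤ (c1 * c2) * (c1 * c2) := by
          have := mul_le_mul e2 e1 (mul_nonneg n1 n3) (sq_nonneg c1)
          nlinarith
        exact le_of_mul_le_mul_right this (mul_pos h h2)
    have q0 : 0 ≤ 1 - p i := by linarith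
    have t1 := mul_le_mul_of_nonneg_left e1 (sq_nonneg (1 - p i))
    have t2 := mul_le_mul_of_nonneg_left e2 (sq_nonneg (p i))
    have t3 := mul_le_mul_of_nonneg_left key (mul_nonneg q0 h3.1)
    nlinarith

lemma Ef_neg (S : Finset ℕ) (p f : ℕ → ℝ) : Ef S p (fun a => - f a) = - Ef S p f := by
  unfold Ef
  rw [← Finset.sum_neg_distrib]
  exact Finset.sum_congr rfl fun A _ => by ring

/-- Monotonicity in the success probabilities. -/
lemma Ef_mono_p {S : Finset ℕ} {p q : ℕ → ℝ} (hp : ∀ i ∈ S, 0 ≤ p i ∧ p i ≤ 1)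
    (hq : ∀ i ∈ S, 0 ≤ q i ∧ q i ≤ 1) (hpq : ∀ i ∈ S, p i ≤ q i) {f : ℕ → ℝ}
    (hf : Monotone f) : Ef S p f ≤ Ef S q f := by
  induction S using Finset.induction_on generalizing f with
  | empty => simp [Ef_empty]
  | insert i S hi ih =>
    have ih' := @ih (fun j hj => hp j (Finset.mem_insert_of_mem hj))
      (fun j hj => hq j (Finset.mem_insert_of_mem hj))
      (fun j hj => hpq j (Finset.mem_insert_of_mem hj))
    rw [Ef_insert hi, Ef_insert hi]
    have h1 := ih' hf
    have h2 := ih' (f := fun a => f (a + 1)) (fun a b hab => hf (by omega))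
    have h3 : Ef S q f ≤ Ef S q (fun a => f (a + 1)) :=
      Ef_mono (fun j hj => hq j (Finset.mem_insert_of_mem hj)) fun a => hf (by omega)
    have a1 := hp i (Finset.mem_insert_self _ _)
    have a2 := hpq i (Finset.mem_insert_self _ _)
    nlinarith [mul_le_mul_of_nonneg_left h1 (sub_nonneg.mpr a1.2),
      mul_le_mul_of_nonneg_left h2 a1.1,
      mul_nonneg (sub_nonneg.mpr a2) (sub_nonneg.mpr h3)]

lemma eS_mono_p {S : Finset ℕ} {p q : ℕ → ℝ} (hp : ∀ i ∈ S, 0 ≤ p i ∧ p i ≤ 1)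
    (hq : ∀ i ∈ S, 0 ≤ q i ∧ q i ≤ 1) (hpq : ∀ i ∈ S, p i ≤ q i) (k : ℕ) :
    eS S p k ≤ eS S q k :=
  Ef_mono_p hp hq hpq fun a b hab => by
    have : (a : ℝ) ≤ b := by exact_mod_cast hab
    exact min_le_min_right _ this

lemma cS_anti_p {S : Finset ℕ} {p q : ℕ → ℝ} (hp : ∀ i ∈ S, 0 ≤ p i ∧ p i ≤ 1)
    (hq : ∀ i ∈ S, 0 ≤ q i ∧ q i ≤ 1) (hpq : ∀ i ∈ S, p i ≤ q i) (k : ℕ) :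
    cS S q k ≤ cS S p k := by
  have := Ef_mono_p hp hq hpq (f := fun a => - (if a < k then (1 : ℝ) else 0)) fun a b hab => by
    dsimp only
    split_ifs <;> first | omega | norm_num
  rw [Ef_neg, Ef_neg] at this
  exact neg_le_neg_iff.mp this

/-- One-coordinate version of the monotonicity of the ratio `P(T<k-1)/P(T<k)`. -/
lemma ratio_step {T : Finset ℕ} {i : ℕ} (hi : i ∉ T) {p q : ℕ → ℝ}
    (hp : ∀ j ∈ T, 0 ≤ p j ∧ p j ≤ 1) (hpq : ∀ j ∈ T, p j = q j) (h : p i ≤ q i) (k : ℕ) :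
    cS (insert i T) q (k - 1) * cS (insert i T) p k ≤
      cS (insert i T) p (k - 1) * cS (insert i T) q k := by
  rw [cS_insert hi, cS_insert hi, cS_insert hi, cS_insert hi]
  have e : ∀ j, cS T q j = cS T p j := fun j => (Ef_congr hpq _).symm
  rw [e, e, e]
  have := mul_le_mul_of_nonneg_left (cS_logconcave hp k) (sub_nonneg.mpr h)
  nlinarith

lemma ratio_mono {S : Finset ℕ} {p q : ℕ → ℝ} (hp : ∀ i ∈ S, 0 ≤ p i ∧ p i ≤ 1)
    (hq : ∀ i ∈ S, 0 ≤ q i ∧ q i ≤ 1) (hpq : ∀ i ∈ S, p i ≤ q i) (k : ℕ) :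
    cS S q (k - 1) * cS S p k ≤ cS S p (k - 1) * cS S q k := by
  have main : ∀ A : Finset ℕ, A ⊆ S →
      cS S (A.piecewise q p) (k - 1) * cS S p k ≤
        cS S p (k - 1) * cS S (A.piecewise q p) k := by
    intro A
    induction A using Finset.induction_on with
    | empty => intro _; simp
    | insert i A hi ih =>
      intro hA
      have hAS : A ⊆ S := fun x hx => hA (Finset.mem_insert_of_mem hx)
      have hiS : i ∈ S := hA (Finset.mem_insert_self _ _)
      have IH := ih hAS
      have hm : ∀ B : Finset ℕ, ∀ j ∈ S, 0 ≤ B.piecewise q p j ∧ B.piecewise q p j ≤ 1 := by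
        intro B j hj
        by_cases hB : j ∈ B
        · simpa [hB] using hq j hj
        · simpa [hB] using hp j hj
      have st := ratio_step (T := S.erase i) (i := i) (Finset.notMem_erase _ _)
        (p := A.piecewise q p) (q := (insert i A).piecewise q p)
        (fun j hj => hm A j (Finset.mem_of_mem_erase hj))
        (fun j hj => by
          have : j ≠ i := Finset.ne_of_mem_erase hj
          by_cases hB : j ∈ A <;> simp [hB, this])
        (by simp [hi, hpq i hiS]) k
      rw [Finset.insert_erase hiS] at st
      have an : cS S ((insert i A).piecewise q p) k ≤ cS S (A.piecewise q p) k :=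
        cS_anti_p (hm A) (hm _) (fun j hj => by
          by_cases h1 : j ∈ A
          · simp [h1]
          · by_cases h2 : j = i
            · subst h2; simp [h1, hpq j hj]
            · simp [h1, h2]) k
      have q1 : cS S ((insert i A).piecewise q p) (k - 1) ≤ cS S ((insert i A).piecewise q p) k :=
        cS_mono (hm _) (by omega)
      have n1 := cS_nonneg (hm (insert i A)) (k - 1)
      have n2 := cS_nonneg (hm (insert i A)) k
      have n3 := cS_nonneg (hm A) k
      have n4 := cS_nonneg hp k
      have n5 := cS_nonneg hp (k - 1)
      generalize cS S ((insert i A).piecewise q p) (k - 1) = x1 at *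
      generalize cS S ((insert i A).piecewise q p) k = x0 at *
      generalize cS S (A.piecewise q p) (k - 1) = y1 at *
      generalize cS S (A.piecewise q p) k = y0 at *
      rcases n3.eq_or_lt with h | h
      · have : x0 = 0 := by linarith
        have : x1 = 0 := by linarith
        rw [‹x0 = 0›, ‹x1 = 0›]; simp
      · refine le_of_mul_le_mul_right ?_ h
        nlinarith [mul_le_mul_of_nonneg_right st n4, mul_le_mul_of_nonneg_right IH n2]
  have := main S subset_rfl
  have e : ∀ j, cS S (S.piecewise q p) j = cS S q j := fun j =>
    Ef_congr (fun i hi => by simp [hi]) _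
  rwa [e, e] at this

/-- The pair (`R`,`e`) traced by binomial distributions is concave: tangent inequality. -/
lemma binom_tangent (N k : ℕ) {ρ σ : ℝ} (hρ0 : 0 ≤ ρ) (hρ1 : ρ ≤ 1)
    (hσ0 : 0 ≤ σ) (hσ1 : σ ≤ 1) :
    cS (Icc 1 (N - 1)) (fun _ => ρ) k * cS (Icc 1 N) (fun _ => σ) k +
      (cS (Icc 1 (N - 1)) (fun _ => ρ) k - cS (Icc 1 (N - 1)) (fun _ => ρ) (k - 1)) *
        eS (Icc 1 N) (fun _ => σ) k ≤
    cS (Icc 1 (N - 1)) (fun _ => ρ) k * cS (Icc 1 N) (fun _ => ρ) k +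
      (cS (Icc 1 (N - 1)) (fun _ => ρ) k - cS (Icc 1 (N - 1)) (fun _ => ρ) (k - 1)) *
        eS (Icc 1 N) (fun _ => ρ) k := by
  have main : ∀ t, t ≤ N →
    cS (Icc 1 (N - 1)) (fun _ => ρ) k * cS (Icc 1 N) (fun i => if i ≤ t then σ else ρ) k +
      (cS (Icc 1 (N - 1)) (fun _ => ρ) k - cS (Icc 1 (N - 1)) (fun _ => ρ) (k - 1)) *
        eS (Icc 1 N) (fun i => if i ≤ t then σ else ρ) k ≤
    cS (Icc 1 (N - 1)) (fun _ => ρ) k * cS (Icc 1 N) (fun _ => ρ) k +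
      (cS (Icc 1 (N - 1)) (fun _ => ρ) k - cS (Icc 1 (N - 1)) (fun _ => ρ) (k - 1)) *
        eS (Icc 1 N) (fun _ => ρ) k := by
    intro t
    induction t with
    | zero =>
      intro _
      have e : ∀ f, Ef (Icc 1 N) (fun i => if i ≤ 0 then σ else ρ) f
          = Ef (Icc 1 N) (fun _ => ρ) f := fun f => Ef_congr (fun i hi => by
            rw [Finset.mem_Icc] at hi
            rw [if_neg (by omega)]) f
      unfold cS eS
      rw [e, e]
    | succ t ih =>
      intro ht
      refine le_trans ?_ (ih (by omega))
      have hmem : t + 1 ∈ Icc 1 N := Finset.mem_Icc.mpr ⟨by omega, ht⟩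
      set T := (Icc 1 N).erase (t + 1) with hT
      have hnot : t + 1 ∉ T := Finset.notMem_erase _ _
      have hins : Icc 1 N = insert (t + 1) T := (Finset.insert_erase hmem).symm
      have hcard : (Icc 1 (N - 1)).card = T.card := by
        rw [hT, Finset.card_erase_of_mem hmem]; simp
      have ec : ∀ j, cS (Icc 1 (N - 1)) (fun _ => ρ) j = cS T (fun _ => ρ) j :=
        fun j => Ef_card hcard ρ _
      rw [hins, cS_insert hnot, cS_insert hnot, eS_insert hnot, eS_insert hnot, ec, ec]
      have ee : ∀ f, Ef T (fun i => if i ≤ t + 1 then σ else ρ) f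
          = Ef T (fun i => if i ≤ t then σ else ρ) f := fun f => Ef_congr (fun i hi => by
            have : i ≠ t + 1 := Finset.ne_of_mem_erase hi
            have : i ≤ t + 1 ↔ i ≤ t := by omega
            simp only [this]) f
      have ee1 : ∀ j, cS T (fun i => if i ≤ t + 1 then σ else ρ) j
          = cS T (fun i => if i ≤ t then σ else ρ) j := fun j => ee _
      have ee2 : ∀ j, eS T (fun i => if i ≤ t + 1 then σ else ρ) j
          = eS T (fun i => if i ≤ t then σ else ρ) j := fun j => ee _
      rw [ee1, ee1, ee2]
      have i1 : (if t + 1 ≤ t + 1 then σ else ρ) = σ := if_pos le_rfl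
      have i2 : (if t + 1 ≤ t then σ else ρ) = ρ := if_neg (by omega)
      rw [i1, i2]
      have b1 : ∀ i ∈ T, 0 ≤ (fun _ : ℕ => ρ) i ∧ (fun _ : ℕ => ρ) i ≤ 1 :=
        fun i _ => ⟨hρ0, hρ1⟩
      have b2 : ∀ i ∈ T, 0 ≤ (fun i : ℕ => if i ≤ t then σ else ρ) i ∧
          (fun i : ℕ => if i ≤ t then σ else ρ) i ≤ 1 := by
        intro i _
        dsimp only
        split_ifs
        exacts [⟨hσ0, hσ1⟩, ⟨hρ0, hρ1⟩]
      have key : (σ - ρ) * (cS T (fun _ => ρ) k * cS T (fun i => if i ≤ t then σ else ρ) (k - 1)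
          - cS T (fun _ => ρ) (k - 1) * cS T (fun i => if i ≤ t then σ else ρ) k) ≤ 0 := by
        rcases le_total ρ σ with h | h
        · have := ratio_mono b1 b2 (fun i _ => by
            split_ifs
            exacts [h, le_rfl]) k
          exact mul_nonpos_of_nonneg_of_nonpos (by linarith) (by linarith)
        · have := ratio_mono b2 b1 (fun i _ => by
            split_ifs
            exacts [h, le_rfl]) k
          exact mul_nonpos_of_nonpos_of_nonneg (by linarith) (by linarith)
      nlinarith
  have := main N le_rfl
  have e : ∀ f, Ef (Icc 1 N) (fun i => if i ≤ N then σ else ρ) f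
      = Ef (Icc 1 N) (fun _ => σ) f := fun f => Ef_congr (fun i hi => by
        rw [Finset.mem_Icc] at hi
        rw [if_pos (by omega)]) f
  have e1 : cS (Icc 1 N) (fun i => if i ≤ N then σ else ρ) k = cS (Icc 1 N) (fun _ => σ) k := e _
  have e2 : eS (Icc 1 N) (fun i => if i ≤ N then σ else ρ) k = eS (Icc 1 N) (fun _ => σ) k := e _
  rwa [e1, e2] at this

/-- Algebraic smoothing step. -/
lemma smooth_alg {c0 c1 c2 x y ρ : ℝ} (h2 : 0 ≤ c2) (h1 : c2 ≤ c1) (h0 : c1 ≤ c0)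
    (hl : c2 * c0 ≤ c1 ^ 2) (hx : 0 ≤ x) (hxρ : x < ρ) (hρy : ρ < y) (hy : y ≤ 1) :
    ∃ z, 0 ≤ z ∧ z ≤ 1 ∧
      z * c0 + ρ * ((1 - z) * c0 + z * c1) = y * c0 + x * ((1 - y) * c0 + y * c1) ∧
      (1 - ρ) * ((1 - z) * c0 + z * c1) + ρ * ((1 - z) * c1 + z * c2) ≤
      (1 - x) * ((1 - y) * c0 + y * c1) + x * ((1 - y) * c1 + y * c2) := by
  rcases (le_trans h2 (h1.trans h0)).eq_or_lt with h | hc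
  · have e1 : c1 = 0 := by linarith
    have e2 : c2 = 0 := by linarith
    exact ⟨y, by linarith, hy, by rw [← h, e1]; ring, by rw [← h, e1, e2]; simp⟩
  · have ha : 0 ≤ c0 - c1 := by linarith
    have hac : c0 - c1 ≤ c0 := by linarith
    have hd : 0 < c0 - (c0 - c1) * ρ := by nlinarith
    have hdx : 0 < c0 - (c0 - c1) * x := by nlinarith
    have hdy : 0 ≤ c0 - (c0 - c1) * y := by nlinarith
    obtain ⟨z, hz⟩ : ∃ z, z * (c0 - (c0 - c1) * ρ) = c0 * (x + y) - (c0 - c1) * x * y - c0 * ρ :=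
      ⟨(c0 * (x + y) - (c0 - c1) * x * y - c0 * ρ) / (c0 - (c0 - c1) * ρ),
        div_mul_cancel₀ _ hd.ne'⟩
    have hzy : z ≤ y := by
      refine le_of_mul_le_mul_right ?_ hd
      nlinarith [mul_nonneg hdy (sub_nonneg.mpr hxρ.le)]
    have hzx : x ≤ z := by
      refine le_of_mul_le_mul_right ?_ hd
      nlinarith [mul_nonneg hdx.le (sub_nonneg.mpr hρy.le)]
    have hpp : 0 ≤ ρ * z - x * y := by
      have e : (c0 - (c0 - c1) * x) * (ρ * z - x * y) = c0 * ((ρ - x) * (z - x)) := by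
        linear_combination x * hz
      have : 0 ≤ (c0 - (c0 - c1) * x) * (ρ * z - x * y) := by
        rw [e]
        exact mul_nonneg hc.le (mul_nonneg (by linarith) (by linarith))
      exact nonneg_of_mul_nonneg_right this hdx
    refine ⟨z, by linarith, by linarith, by linear_combination hz, ?_⟩
    refine le_of_mul_le_mul_left ?_ hc
    have := mul_nonneg hpp (sub_nonneg.mpr hl)
    have e : c0 * ((1 - ρ) * ((1 - z) * c0 + z * c1) + ρ * ((1 - z) * c1 + z * c2)) -
      c0 * ((1 - x) * ((1 - y) * c0 + y * c1) + x * ((1 - y) * c1 + y * c2)) =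
      - ((ρ * z - x * y) * (c1 ^ 2 - c2 * c0)) := by
      linear_combination (-(c0 - c1)) * hz
    linarith

/-- Among all vectors with `e` at most that of the constant vector, the constant one
minimizes `R`. -/
lemma smooth_main (S : Finset ℕ) (k : ℕ) (hk : 1 ≤ k) {ρ : ℝ} (hρ0 : 0 < ρ) (hρ1 : ρ < 1) :
    ∀ d : ℕ, ∀ p : ℕ → ℝ, (∀ i ∈ S, 0 ≤ p i ∧ p i ≤ 1) →
      (S.filter fun i => p i ≠ ρ).card ≤ d →
      eS S p k ≤ eS S (fun _ => ρ) k → cS S (fun _ => ρ) k ≤ cS S p k := by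
  have bρ : ∀ i ∈ S, 0 ≤ (fun _ : ℕ => ρ) i ∧ (fun _ : ℕ => ρ) i ≤ 1 :=
    fun i _ => ⟨hρ0.le, hρ1.le⟩
  intro d
  induction d with
  | zero =>
    intro p hp hd _
    have : ∀ i ∈ S, p i = ρ := by
      intro i hi
      by_contra h
      have : i ∈ S.filter fun i => p i ≠ ρ := by simp [hi, h]
      rw [Nat.le_zero, Finset.card_eq_zero] at hd
      simp [hd] at this
    exact (Ef_congr this _).ge
  | succ d ih =>
    intro p hp hd he
    by_cases hA : ∀ i ∈ S, p i ≤ ρ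
    · exact cS_anti_p hp bρ hA k
    push Not at hA
    obtain ⟨j, hj, hjρ⟩ := hA
    by_cases hB : ∀ i ∈ S, ρ ≤ p i
    · exfalso
      have hjn := Finset.notMem_erase j S
      have hb : ∀ i ∈ S, 0 ≤ Function.update (fun _ : ℕ => ρ) j (p j) i ∧
          Function.update (fun _ : ℕ => ρ) j (p j) i ≤ 1 := by
        intro i hi
        by_cases h : i = j
        · subst h; simpa using hp i hi
        · simpa [h] using ⟨hρ0.le, hρ1.le⟩
      have m1 := eS_mono_p hb hp (fun i hi => by
        by_cases h : i = j
        · subst h; simp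
        · simpa [h] using hB i hi) k
      have hc : 0 < cS (S.erase j) (fun _ => ρ) k := cS_pos (fun _ _ => ⟨hρ0.le, hρ1⟩) hk
      rw [← Finset.insert_erase hj, eS_insert hjn, eS_insert hjn] at m1
      rw [← Finset.insert_erase hj, eS_insert hjn, eS_insert hjn] at he
      have e : ∀ f, Ef (S.erase j) (Function.update (fun _ : ℕ => ρ) j (p j)) f
          = Ef (S.erase j) (fun _ : ℕ => ρ) f := fun f => Ef_congr (fun i hi => by
            simp [Finset.ne_of_mem_erase hi]) f
      have e1 : eS (S.erase j) (Function.update (fun _ : ℕ => ρ) j (p j)) k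
          = eS (S.erase j) (fun _ : ℕ => ρ) k := e _
      have e2 : cS (S.erase j) (Function.update (fun _ : ℕ => ρ) j (p j)) k
          = cS (S.erase j) (fun _ : ℕ => ρ) k := e _
      rw [e1, e2, Function.update_self] at m1
      nlinarith
    push Not at hB
    obtain ⟨i, hi, hiρ⟩ := hB
    have hij : i ≠ j := by rintro rfl; linarith
    set T := (S.erase i).erase j with hT
    have hjT : j ∉ T := Finset.notMem_erase _ _
    have hiT : i ∉ insert j T := by simp [hT, hij]
    have hS : S = insert i (insert j T) := by
      rw [hT, Finset.insert_erase (Finset.mem_erase.mpr ⟨hij.symm, hj⟩), Finset.insert_erase hi]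
    have hpT : ∀ a ∈ T, 0 ≤ p a ∧ p a ≤ 1 := fun a ha =>
      hp a (Finset.mem_of_mem_erase (Finset.mem_of_mem_erase ha))
    have cform : ∀ q : ℕ → ℝ, cS S q k = (1 - q i) * ((1 - q j) * cS T q k + q j * cS T q (k - 1))
        + q i * ((1 - q j) * cS T q (k - 1) + q j * cS T q (k - 1 - 1)) := by
      intro q; rw [hS, cS_insert hiT, cS_insert hjT, cS_insert hjT]
    have eform : ∀ q : ℕ → ℝ, eS S q k = eS T q k + (q j * cS T q k +
        q i * ((1 - q j) * cS T q k + q j * cS T q (k - 1))) := by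
      intro q; rw [hS, eS_insert hiT, cS_insert hjT, eS_insert hjT]; ring
    obtain ⟨z, hz0, hz1, hze, hzR⟩ := smooth_alg (cS_nonneg hpT (k - 1 - 1))
      (cS_mono hpT (by omega)) (cS_mono hpT (by omega)) (cS_logconcave hpT k)
      (hp i hi).1 hiρ hjρ (hp j hj).2
    set q := Function.update (Function.update p i ρ) j z with hq
    have qi : q i = ρ := by simp [hq, hij]
    have qj : q j = z := by simp [hq]
    have qo : ∀ a, a ≠ i → a ≠ j → q a = p a := fun a h1 h2 => by simp [hq, h1, h2]
    have eT : ∀ f, Ef T q f = Ef T p f := fun f => Ef_congr (fun a ha => by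
      have h1 := Finset.ne_of_mem_erase ha
      have h2 := Finset.ne_of_mem_erase (Finset.mem_of_mem_erase ha)
      exact qo a h2 h1) f
    have eT1 : ∀ b, cS T q b = cS T p b := fun b => eT _
    have eT2 : ∀ b, eS T q b = eS T p b := fun b => eT _
    have hcq : cS S q k ≤ cS S p k := by
      rw [cform q, cform p, eT1, eT1, eT1, qi, qj]; exact hzR
    have heq : eS S q k = eS S p k := by
      rw [eform q, eform p, eT1, eT1, eT2, qi, qj, hze]
    refine le_trans (ih q ?_ ?_ (heq.trans_le he)) hcq
    · intro a ha
      by_cases h1 : a = i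
      · subst h1; rw [qi]; exact ⟨hρ0.le, hρ1.le⟩
      by_cases h2 : a = j
      · subst h2; rw [qj]; exact ⟨hz0, hz1⟩
      rw [qo a h1 h2]; exact hp a ha
    · have : (S.filter fun a => q a ≠ ρ) ⊂ (S.filter fun a => p a ≠ ρ) := by
        rw [Finset.ssubset_iff_of_subset]
        · exact ⟨i, by simp [hi, hiρ.ne], by simp [qi]⟩
        · intro a ha
          rw [Finset.mem_filter] at ha ⊢
          refine ⟨ha.1, ?_⟩
          by_cases h1 : a = i
          · subst h1; exact hiρ.ne
          by_cases h2 : a = j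
          · subst h2; exact hjρ.ne'
          rw [← qo a h1 h2]; exact ha.2
      have := Finset.card_lt_card this
      omega

lemma Icc_succ_insert {i : ℕ} (hi : 1 ≤ i) : Icc 1 i = insert i (Icc 1 (i - 1)) := by
  ext a; simp only [Finset.mem_Icc, Finset.mem_insert]; omega

lemma Icc_pred_notMem {i : ℕ} (hi : 1 ≤ i) : i ∉ Icc 1 (i - 1) := by
  simp only [Finset.mem_Icc]; omega

/-- Explicit state probabilities of a static threshold policy. -/
noncomputable def Xs (τ : ℕ → ℝ) (k i l : ℕ) : ℝ :=
  Ef (Icc 1 (i - 1)) τ (fun a => if a + l = k then 1 else 0)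

lemma Xs_rec (τ : ℕ → ℝ) (k : ℕ) {i : ℕ} (hi : 2 ≤ i) (l : ℕ) :
    Xs τ k i l = Xs τ k (i - 1) l - τ (i - 1) * Xs τ k (i - 1) l
      + τ (i - 1) * Xs τ k (i - 1) (l + 1) := by
  unfold Xs
  rw [Icc_succ_insert (i := i - 1) (by omega), Ef_insert (Icc_pred_notMem (by omega))]
  have : (fun a => if a + 1 + l = k then (1 : ℝ) else 0) =
      fun a => if a + (l + 1) = k then (1 : ℝ) else 0 := by
    funext a
    have : a + 1 + l = k ↔ a + (l + 1) = k := by omega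
    simp only [this]
  rw [this]; ring

lemma Xs_top (τ : ℕ → ℝ) (k i : ℕ) : Xs τ k i (k + 1) = 0 := by
  unfold Xs
  have : (fun a => if a + (k + 1) = k then (1 : ℝ) else 0) = fun _ => 0 := by
    funext a; rw [if_neg (by omega)]
  rw [this, Ef_const]

lemma Xs_nonneg {τ : ℕ → ℝ} {n : ℕ} (hτ : ∀ i ∈ Icc 1 n, 0 ≤ τ i ∧ τ i ≤ 1) (k : ℕ) {i : ℕ}
    (hi : i ≤ n) (l : ℕ) : 0 ≤ Xs τ k i l := by
  have := Ef_mono (S := Icc 1 (i - 1)) (p := τ) (f := fun _ => 0)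
    (g := fun a => if a + l = k then 1 else 0)
    (fun a ha => hτ a (by rw [Finset.mem_Icc] at ha ⊢; omega))
    (fun a => by split_ifs <;> norm_num)
  rwa [Ef_const] at this

lemma Xs_one (τ : ℕ → ℝ) (k l : ℕ) : Xs τ k 1 l = if l = k then 1 else 0 := by
  unfold Xs
  simp [Ef_empty]

lemma sum_Xs (τ : ℕ → ℝ) (k i : ℕ) :
    ∑ l ∈ Icc 1 k, Xs τ k i l = cS (Icc 1 (i - 1)) τ k := by
  unfold Xs cS
  rw [← Ef_sum]
  congr 1
  funext a
  split_ifs with h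
  · rw [Finset.sum_eq_single (k - a)]
    · rw [if_pos (by omega)]
    · intro b hb hne
      rw [if_neg (by omega)]
    · intro hb
      exact absurd (Finset.mem_Icc.mpr (by omega)) hb
  · refine Finset.sum_eq_zero fun l hl => ?_
    rw [Finset.mem_Icc] at hl
    rw [if_neg (by omega)]

lemma memP_Xs {τ : ℕ → ℝ} {n : ℕ} (hτ : ∀ i ∈ Icc 1 n, 0 ≤ τ i ∧ τ i ≤ 1) (k : ℕ) :
    memP k n (Xs τ k) (fun i l => τ i * Xs τ k i l) := by
  refine ⟨by simp [Xs_one], fun l _ hl => by rw [Xs_one, if_neg (by omega)], ?_, ?_⟩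
  · intro i hi l hl
    rw [Finset.mem_Icc] at hi hl
    rw [Xs_rec τ k hi.1 l]
    split_ifs with h
    · rfl
    · have : l = k := by omega
      rw [this, Xs_top]; simp
  · intro i hi l hl
    have h0 := Xs_nonneg hτ k (Finset.mem_Icc.mp hi).2 l
    have := hτ i hi
    exact ⟨mul_nonneg this.1 h0, mul_le_of_le_one_left h0 this.2⟩

lemma memP_unique {τ : ℕ → ℝ} {k n : ℕ} {x y : ℕ → ℕ → ℝ} (h : memP k n x y)
    (hy : ∀ i ∈ Icc 1 n, ∀ l ∈ Icc 1 k, y i l = τ i * x i l) :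
    ∀ i, 1 ≤ i → i ≤ n → ∀ l ∈ Icc 1 k, x i l = Xs τ k i l := by
  obtain ⟨h1, h2, h3, h4⟩ := h
  intro i hi
  induction i, hi using Nat.le_induction with
  | base =>
    intro _ l hl
    rw [Finset.mem_Icc] at hl
    rw [Xs_one]
    split_ifs with e
    · rw [e, h1]
    · exact h2 l hl.1 (by omega)
  | succ i hi ih =>
    intro hin l hl
    have hl' := Finset.mem_Icc.mp hl
    have IH := ih (by omega)
    rw [h3 (i + 1) (Finset.mem_Icc.mpr ⟨by omega, hin⟩) l hl, Xs_rec τ k (by omega) l]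
    have hi' : i ∈ Icc 1 n := Finset.mem_Icc.mpr ⟨hi, by omega⟩
    simp only [Nat.add_sub_cancel]
    rw [hy i hi' l hl, IH l hl]
    split_ifs with e
    · have hl2 : l + 1 ∈ Icc 1 k := Finset.mem_Icc.mpr ⟨by omega, by omega⟩
      rw [hy i hi' _ hl2, IH _ hl2]
    · have : l = k := by omega
      rw [this, Xs_top]; simp

lemma coverSum_eq {τ : ℕ → ℝ} {k n : ℕ} (hτ : ∀ i ∈ Icc 1 n, 0 ≤ τ i ∧ τ i ≤ 1)
    {x y : ℕ → ℕ → ℝ} (h : memP k n x y)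
    (hy : ∀ i ∈ Icc 1 n, ∀ l ∈ Icc 1 k, y i l = τ i * x i l) (G : ℕ → ℕ → ℝ) (j : ℕ) :
    coverSum k n G j x y = ∑ i ∈ Icc 1 n, min (τ i) (G i j) * cS (Icc 1 (i - 1)) τ k := by
  unfold coverSum
  refine Finset.sum_congr rfl fun i hi => ?_
  have hi' := Finset.mem_Icc.mp hi
  rw [← sum_Xs, Finset.mul_sum]
  refine Finset.sum_congr rfl fun l hl => ?_
  rw [hy i hi l hl, memP_unique h hy i hi'.1 hi'.2 l hl,
    min_mul_of_nonneg _ _ (Xs_nonneg hτ k hi'.2 l)]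

lemma eS_sum (τ : ℕ → ℝ) (k n : ℕ) :
    eS (Icc 1 n) τ k = ∑ i ∈ Icc 1 n, τ i * cS (Icc 1 (i - 1)) τ k := by
  induction n with
  | zero => simp [eS, Ef_empty]
  | succ n ih =>
    have h1 : n + 1 ∉ Icc 1 n := by simp
    have h2 : Icc 1 (n + 1) = insert (n + 1) (Icc 1 n) := Icc_succ_insert (by omega)
    rw [h2, eS_insert h1, Finset.sum_insert h1, ih]
    simp only [Nat.add_sub_cancel]
    ring

lemma typeDist_mono {n m : ℕ} {G : ℕ → ℕ → ℝ} (hG : IsTypeDist n m G) {i : ℕ}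
    (hi : i ∈ Icc 1 n) {a b : ℕ} (hab : a ≤ b) (hb : b ≤ m) : G i a ≤ G i b := by
  induction b, hab using Nat.le_induction with
  | base => exact le_rfl
  | succ b hab ih =>
    have := (hG i hi).2.2 (b + 1) (Finset.mem_Icc.mpr ⟨by omega, hb⟩)
    simp only [Nat.add_sub_cancel] at this
    exact (ih (by omega)).trans this

lemma typeDist_bd {n m : ℕ} {G : ℕ → ℕ → ℝ} (hG : IsTypeDist n m G) {i : ℕ}
    (hi : i ∈ Icc 1 n) {a : ℕ} (ha : a ≤ m) : 0 ≤ G i a ∧ G i a ≤ 1 := by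
  have h1 := typeDist_mono hG hi (Nat.zero_le a) ha
  have h2 := typeDist_mono hG hi ha le_rfl
  rw [(hG i hi).1] at h1
  rw [(hG i hi).2.1] at h2
  exact ⟨h1, h2⟩

lemma tau_between {n m : ℕ} {G : ℕ → ℕ → ℝ} (hG : IsTypeDist n m G) {i : ℕ}
    (hi : i ∈ Icc 1 n) {J : ℕ} (hJ : J ∈ Icc 1 m) {ρ : ℝ} (h0 : 0 ≤ ρ) (h1 : ρ ≤ 1) :
    G i (J - 1) ≤ tauOf G J ρ i ∧ tauOf G J ρ i ≤ G i J := by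
  have := (hG i hi).2.2 J hJ
  unfold tauOf
  constructor <;> nlinarith

lemma tau_bd {n m : ℕ} {G : ℕ → ℕ → ℝ} (hG : IsTypeDist n m G) {J : ℕ} (hJ : J ∈ Icc 1 m)
    {ρ : ℝ} (h0 : 0 ≤ ρ) (h1 : ρ ≤ 1) : ∀ i ∈ Icc 1 n, 0 ≤ tauOf G J ρ i ∧ tauOf G J ρ i ≤ 1 := by
  intro i hi
  have hJ' := Finset.mem_Icc.mp hJ
  have a := tau_between hG hi hJ h0 h1
  have b := typeDist_bd hG hi hJ'.2
  have c := typeDist_bd hG hi (a := J - 1) (by omega)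
  exact ⟨c.1.trans a.1, a.2.trans b.2⟩

lemma cS_prefix {τ : ℕ → ℝ} {n : ℕ} (hτ : ∀ i ∈ Icc 1 n, 0 ≤ τ i ∧ τ i ≤ 1) (k : ℕ) {a b : ℕ}
    (hab : a ≤ b) (hb : b ≤ n) : cS (Icc 1 b) τ k ≤ cS (Icc 1 a) τ k := by
  induction b, hab using Nat.le_induction with
  | base => exact le_rfl
  | succ b hab ih =>
    refine le_trans ?_ (ih (by omega))
    have hb' : ∀ i ∈ Icc 1 b, 0 ≤ τ i ∧ τ i ≤ 1 := fun i hi => hτ i (by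
      rw [Finset.mem_Icc] at hi ⊢; omega)
    have h1 : b + 1 ∉ Icc 1 b := by simp
    have h2 : Icc 1 (b + 1) = insert (b + 1) (Icc 1 b) := Icc_succ_insert (by omega)
    rw [h2, cS_insert h1]
    have m := cS_mono hb' (show k - 1 ≤ k by omega)
    have := hτ (b + 1) (Finset.mem_Icc.mpr ⟨by omega, hb⟩)
    nlinarith

lemma QProph_eq (k n : ℕ) (G : ℕ → ℕ → ℝ) (j : ℕ) :
    QProph k n G j = eS (Icc 1 n) (fun i => G i j) k := rfl

lemma QProph_le {k n m : ℕ} {G : ℕ → ℕ → ℝ} (hG : IsTypeDist n m G) {j : ℕ} (hj : j ≤ m) :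
    QProph k n G j ≤ QExAnte k n G j := by
  have hb : ∀ i ∈ Icc 1 n, 0 ≤ (fun i => G i j) i ∧ (fun i => G i j) i ≤ 1 :=
    fun i hi => typeDist_bd hG hi hj
  rw [QProph_eq]
  refine le_min ?_ (eS_le hb k)
  rw [eS_sum]
  refine Finset.sum_le_sum fun i hi => ?_
  refine mul_le_of_le_one_right (hb i hi).1 (cS_le_one (fun a ha => hb a ?_) k)
  rw [Finset.mem_Icc] at ha hi ⊢; omega

lemma QProph_top {k n m : ℕ} {G : ℕ → ℕ → ℝ} (hG : IsTypeDist n m G) (hkn : k ≤ n) :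
    QProph k n G m = k := by
  rw [QProph_eq, eS, Ef_one _ _ _ fun i hi => (hG i hi).2.1]
  simp [hkn]

lemma cover_le {k n m : ℕ} {G : ℕ → ℕ → ℝ} (hG : IsTypeDist n m G) {J : ℕ} (hJ : J ∈ Icc 1 m)
    {ρ : ℝ} (h0 : 0 ≤ ρ) (h1 : ρ ≤ 1) {x y : ℕ → ℕ → ℝ} (h : memP k n x y)
    (hy : ∀ i ∈ Icc 1 n, ∀ l ∈ Icc 1 k, y i l = tauOf G J ρ i * x i l) (j : ℕ) :
    coverSum k n G j x y ≤ k := by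
  have hτ := tau_bd hG hJ h0 h1
  rw [coverSum_eq hτ h hy]
  refine le_trans ?_ (eS_le hτ k)
  rw [eS_sum]
  refine Finset.sum_le_sum fun i hi => mul_le_mul_of_nonneg_right (min_le_left _ _) ?_
  refine cS_nonneg (fun a ha => hτ a ?_) k
  rw [Finset.mem_Icc] at ha hi ⊢; omega

/-- Lower bound: some static threshold reaches `v` against the ex-ante benchmark. -/
lemma lower_bound {k n m : ℕ} (hk : 1 ≤ k) (hkn : k < n) {ρ v : ℝ}
    (hρ0 : 0 < ρ) (hρ1 : ρ < 1) (hv0 : 0 < v) (hv1 : v ≤ 1)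
    (he : eS (Icc 1 (n - 1)) (fun _ => ρ) k = k * v)
    (hR : cS (Icc 1 (n - 1)) (fun _ => ρ) k = v)
    {G : ℕ → ℕ → ℝ} (hG : IsTypeDist n m G) :
    ∃ J ∈ Icc 1 m, ∃ r ∈ Set.Ioc (0:ℝ) 1, ∃ x y, memP k n x y ∧
      (∀ i ∈ Icc 1 n, ∀ l ∈ Icc 1 k, y i l = tauOf G J r i * x i l) ∧
      ∀ j ∈ Icc 1 m, v * QExAnte k n G j ≤ coverSum k n G j x y := by
  have hkpos : (0:ℝ) < k := by exact_mod_cast hk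
  have hex : ∃ J, J ≤ m ∧ k * v ≤ eS (Icc 1 n) (fun i => G i J) k :=
    ⟨m, le_rfl, by
      have := QProph_top hG hkn.le
      rw [QProph_eq] at this
      rw [this]; nlinarith⟩
  classical
  obtain ⟨hJm, hJe⟩ := Nat.find_spec hex
  have hmin := fun a => Nat.find_min hex (m := a)
  set J := Nat.find hex with hJdef
  have hJ1 : 1 ≤ J := by
    by_contra hlt
    have hJ0 : J = 0 := by omega
    rw [hJ0, eS, Ef_zero _ _ _ fun i hi => (hG i hi).1] at hJe
    have : min (((0:ℕ)) : ℝ) (k : ℝ) = 0 := by simp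
    rw [this] at hJe
    nlinarith [mul_pos hkpos hv0]
  have hJmem : J ∈ Icc 1 m := Finset.mem_Icc.mpr ⟨hJ1, hJm⟩
  have hprev : eS (Icc 1 n) (fun i => G i (J - 1)) k < k * v := by
    have := hmin (J - 1) (by omega)
    push Not at this
    exact this (by omega)
  have hcont : Continuous fun r => eS (Icc 1 n) (tauOf G J r) k := by
    refine Ef_continuous (Icc 1 n) (fun r => tauOf G J r) (fun i => ?_) _
    unfold tauOf
    fun_prop
  have t0 : eS (Icc 1 n) (tauOf G J 0) k = eS (Icc 1 n) (fun i => G i (J - 1)) k := by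
    congr 1; funext i; simp [tauOf]
  have t1 : eS (Icc 1 n) (tauOf G J 1) k = eS (Icc 1 n) (fun i => G i J) k := by
    congr 1; funext i; simp [tauOf]
  obtain ⟨r, hr, hre⟩ := intermediate_value_Icc (zero_le_one' ℝ) hcont.continuousOn
    (show (k:ℝ) * v ∈ Set.Icc (eS (Icc 1 n) (tauOf G J 0) k) (eS (Icc 1 n) (tauOf G J 1) k) from
      ⟨by rw [t0]; exact hprev.le, by rw [t1]; exact hJe⟩)
  dsimp only at hre
  have hr0 : 0 < r := by
    rcases hr.1.eq_or_lt with h | h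
    · exfalso; rw [← h, t0] at hre; linarith
    · exact h
  set τ := tauOf G J r with hτdef
  have hτ : ∀ i ∈ Icc 1 n, 0 ≤ τ i ∧ τ i ≤ 1 := tau_bd hG hJmem hr.1 hr.2
  refine ⟨J, hJmem, r, ⟨hr0, hr.2⟩, Xs τ k, fun i l => τ i * Xs τ k i l, memP_Xs hτ k,
    fun _ _ _ _ => rfl, ?_⟩
  intro j hj
  have hj' := Finset.mem_Icc.mp hj
  rw [coverSum_eq hτ (memP_Xs hτ k) (fun _ _ _ _ => rfl)]
  have hcn : ∀ i ∈ Icc 1 n, 0 ≤ cS (Icc 1 (i - 1)) τ k := fun i hi =>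
    cS_nonneg (fun a ha => hτ a (by rw [Finset.mem_Icc] at ha hi ⊢; omega)) k
  rcases Nat.lt_or_ge j J with hlt | hge
  · -- small types
    have hτ' : ∀ i ∈ Icc 1 (n - 1), 0 ≤ τ i ∧ τ i ≤ 1 := fun i hi =>
      hτ i (by rw [Finset.mem_Icc] at hi ⊢; omega)
    have hRn : v ≤ cS (Icc 1 (n - 1)) τ k := by
      rw [← hR]
      refine smooth_main _ k hk hρ0 hρ1 _ τ hτ' le_rfl ?_
      rw [he, ← hre, Icc_succ_insert (i := n) (by omega), eS_insert (Icc_pred_notMem (by omega))]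
      have a := (hτ n (Finset.mem_Icc.mpr ⟨by omega, le_rfl⟩)).1
      have b := cS_nonneg hτ' k
      nlinarith [mul_nonneg a b]
    calc v * QExAnte k n G j ≤ v * ∑ i ∈ Icc 1 n, G i j :=
          mul_le_mul_of_nonneg_left (min_le_left _ _) hv0.le
      _ = ∑ i ∈ Icc 1 n, G i j * v := by rw [Finset.mul_sum]; simp_rw [mul_comm]
      _ ≤ _ := by
        refine Finset.sum_le_sum fun i hi => ?_
        have hGj := typeDist_bd hG hi hj'.2
        have h1 : G i j ≤ τ i := (typeDist_mono hG hi (show j ≤ J - 1 by omega) (by omega)).trans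
          (tau_between hG hi hJmem hr.1 hr.2).1
        rw [min_eq_right h1]
        refine mul_le_mul_of_nonneg_left (hRn.trans ?_) hGj.1
        rw [Finset.mem_Icc] at hi
        exact cS_prefix hτ k (by omega) (by omega)
  · calc v * QExAnte k n G j ≤ v * k := mul_le_mul_of_nonneg_left (min_le_right _ _) hv0.le
      _ = ∑ i ∈ Icc 1 n, τ i * cS (Icc 1 (i - 1)) τ k := by rw [← eS_sum, hre, mul_comm]
      _ = _ := by
        refine Finset.sum_congr rfl fun i hi => ?_
        rw [min_eq_left ((tau_between hG hi hJmem hr.1 hr.2).2.trans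
          (typeDist_mono hG hi hge (Finset.mem_Icc.mp hj).2))]

/-- The worst-case type distributions. -/
noncomputable def Gx (n : ℕ) (ε : ℝ) (i j : ℕ) : ℝ :=
  if j = 0 then 0 else if j = 1 then (if i < n then 0 else ε) else
    if j = 2 then (if i < n then 1 else ε) else 1

lemma Gx_typeDist (n : ℕ) {ε : ℝ} (h0 : 0 ≤ ε) (h1 : ε ≤ 1) : IsTypeDist n 3 (Gx n ε) := by
  intro i _
  refine ⟨by simp [Gx], by simp [Gx], ?_⟩
  intro j hj
  rw [Finset.mem_Icc] at hj
  obtain ⟨a, b⟩ := hj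
  interval_cases j
  · norm_num [Gx]; try (split_ifs <;> linarith)
  · norm_num [Gx]; try (split_ifs <;> linarith)
  · norm_num [Gx]; try (split_ifs <;> linarith)

lemma Gx_tau {n J : ℕ} (hJ : J ∈ Icc 1 3) (ε : ℝ) {r : ℝ} (h0 : 0 ≤ r) (h1 : r ≤ 1) :
    ∃ σ, 0 ≤ σ ∧ σ ≤ 1 ∧ ∀ i, i < n → tauOf (Gx n ε) J r i = σ := by
  rw [Finset.mem_Icc] at hJ
  obtain ⟨a, b⟩ := hJ
  interval_cases J
  · exact ⟨0, le_rfl, zero_le_one, fun i hi => by simp [tauOf, Gx, hi]⟩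
  · exact ⟨r, h0, h1, fun i hi => by simp [tauOf, Gx, hi]⟩
  · exact ⟨1, zero_le_one, le_rfl, fun i hi => by simp [tauOf, Gx, hi]⟩

lemma Gx_Q1 {k n : ℕ} (hk : 1 ≤ k) (hkn : k < n) (ε : ℝ) : QProph k n (Gx n ε) 1 = ε := by
  have z : ∀ i ∈ Icc 1 (n - 1), (fun i => Gx n ε i 1) i = 0 := by
    intro i hi
    rw [Finset.mem_Icc] at hi
    simp [Gx, show i < n by omega]
  rw [QProph_eq, Icc_succ_insert (i := n) (by omega), eS_insert (Icc_pred_notMem (by omega)),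
    eS, cS, Ef_zero _ _ _ z, Ef_zero _ _ _ z]
  rw [if_pos (by omega)]
  simp [Gx]

lemma Gx_Q2 {k n : ℕ} (hkn : k < n) {ε : ℝ} (h0 : 0 ≤ ε) (h1 : ε ≤ 1) :
    (k:ℝ) ≤ QProph k n (Gx n ε) 2 := by
  have z : ∀ i ∈ Icc 1 (n - 1), (fun i => Gx n ε i 2) i = 1 := by
    intro i hi
    rw [Finset.mem_Icc] at hi
    simp [Gx, show i < n by omega]
  rw [QProph_eq, Icc_succ_insert (i := n) (by omega), eS_insert (Icc_pred_notMem (by omega)),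
    eS, cS, Ef_one _ _ _ z, Ef_one _ _ _ z]
  have : (k:ℝ) ≤ (n - 1 : ℕ) := by exact_mod_cast (by omega : k ≤ n - 1)
  simp only [Nat.card_Icc, Nat.add_sub_cancel]
  rw [min_eq_right this, if_neg (by omega)]
  simp

lemma Gx_cover {k n J : ℕ} (hkn : k < n) (hJ : J ∈ Icc 1 3) {ε r : ℝ} (hε0 : 0 ≤ ε)
    (hε1 : ε ≤ 1) (h0 : 0 ≤ r) (h1 : r ≤ 1) {x y : ℕ → ℕ → ℝ} (h : memP k n x y)
    (hy : ∀ i ∈ Icc 1 n, ∀ l ∈ Icc 1 k, y i l = tauOf (Gx n ε) J r i * x i l) :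
    ∃ σ, 0 ≤ σ ∧ σ ≤ 1 ∧
      coverSum k n (Gx n ε) 1 x y ≤ ε * cS (Icc 1 (n - 1)) (fun _ => σ) k ∧
      coverSum k n (Gx n ε) 2 x y ≤ eS (Icc 1 (n - 1)) (fun _ => σ) k + ε := by
  obtain ⟨σ, s0, s1, hσ⟩ := Gx_tau (n := n) hJ ε h0 h1
  have hτ := tau_bd (Gx_typeDist n hε0 hε1) hJ h0 h1
  have hc : ∀ f, Ef (Icc 1 (n - 1)) (tauOf (Gx n ε) J r) f = Ef (Icc 1 (n - 1)) (fun _ => σ) f :=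
    fun f => Ef_congr (fun i hi => hσ i (by rw [Finset.mem_Icc] at hi; omega)) f
  have hc1 : cS (Icc 1 (n - 1)) (tauOf (Gx n ε) J r) k = cS (Icc 1 (n - 1)) (fun _ => σ) k := hc _
  have hc2 : eS (Icc 1 (n - 1)) (tauOf (Gx n ε) J r) k = eS (Icc 1 (n - 1)) (fun _ => σ) k := hc _
  have hcn : ∀ i ∈ Icc 1 n, 0 ≤ cS (Icc 1 (i - 1)) (tauOf (Gx n ε) J r) k := fun i hi =>
    cS_nonneg (fun a ha => hτ a (by rw [Finset.mem_Icc] at ha hi ⊢; omega)) k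
  have hnmem : n ∈ Icc 1 n := Finset.mem_Icc.mpr ⟨by omega, le_rfl⟩
  have hcn1 : cS (Icc 1 (n - 1)) (tauOf (Gx n ε) J r) k ≤ 1 :=
    cS_le_one (fun a ha => hτ a (by rw [Finset.mem_Icc] at ha ⊢; omega)) k
  have hcn0 := hcn n hnmem
  refine ⟨σ, s0, s1, ?_, ?_⟩
  · rw [coverSum_eq hτ h hy, Icc_succ_insert (i := n) (by omega),
      Finset.sum_insert (Icc_pred_notMem (by omega)), ← hc1]
    have z : ∑ i ∈ Icc 1 (n - 1), min (tauOf (Gx n ε) J r i) (Gx n ε i 1) *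
        cS (Icc 1 (i - 1)) (tauOf (Gx n ε) J r) k = 0 := by
      refine Finset.sum_eq_zero fun i hi => ?_
      have hi' : i < n := by rw [Finset.mem_Icc] at hi; omega
      have : Gx n ε i 1 = 0 := by simp [Gx, hi']
      rw [this, hσ i hi', min_eq_right s0, zero_mul]
    rw [z, add_zero]
    have : Gx n ε n 1 = ε := by simp [Gx]
    rw [this]
    exact mul_le_mul_of_nonneg_right (min_le_right _ _) hcn0
  · rw [coverSum_eq hτ h hy, Icc_succ_insert (i := n) (by omega),
      Finset.sum_insert (Icc_pred_notMem (by omega)), ← hc2, eS_sum, add_comm]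
    refine add_le_add ?_ ?_
    · refine Finset.sum_le_sum fun i hi => mul_le_mul_of_nonneg_right (min_le_left _ _) ?_
      exact hcn i (by rw [Finset.mem_Icc] at hi ⊢; omega)
    · have : Gx n ε n 2 = ε := by simp [Gx]
      rw [this]
      have := mul_le_mul_of_nonneg_right (min_le_right (tauOf (Gx n ε) J r n) ε) hcn0
      nlinarith

/-- Feasibility of `θ` in the static-threshold problem. -/
def STfeas (k n m : ℕ) (G : ℕ → ℕ → ℝ) (Q : ℕ → ℝ) (θ : ℝ) : Prop :=
  ∃ (μ : Measure (ℕ × ℝ)) (x y : ℕ → ℝ → ℕ → ℕ → ℝ),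
    IsProbabilityMeasure μ ∧
    μ ((Set.Icc 1 m ×ˢ Set.Ioc (0:ℝ) 1)ᶜ) = 0 ∧
    (∀ J ∈ Finset.Icc 1 m, ∀ ρ ∈ Set.Ioc (0:ℝ) 1,
      memP k n (x J ρ) (y J ρ) ∧
      ∀ i ∈ Finset.Icc 1 n, ∀ l ∈ Finset.Icc 1 k,
        y J ρ i l = tauOf G J ρ i * x J ρ i l) ∧
    ∀ j ∈ Finset.Icc 1 m,
      θ * Q j ≤ ∫ Jρ : ℕ × ℝ, coverSum k n G j (x Jρ.1 Jρ.2) (y Jρ.1 Jρ.2) ∂μ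

/-- Feasibility of `θ` in the oblivious static-threshold problem. -/
def OSTfeas (k n m : ℕ) (G : ℕ → ℕ → ℝ) (J : ℕ) (ρ : ℝ) (Q : ℕ → ℝ) (θ : ℝ) : Prop :=
  ∃ x y, memP k n x y ∧
    (∀ i ∈ Finset.Icc 1 n, ∀ l ∈ Finset.Icc 1 k, y i l = tauOf G J ρ i * x i l) ∧
    ∀ j ∈ Finset.Icc 1 m, θ * Q j ≤ coverSum k n G j x y

lemma innerLP_ST_eq (k n m : ℕ) (G : ℕ → ℕ → ℝ) (Q : ℕ → ℝ) :
    innerLP_ST k n m G Q = sSup {θ | STfeas k n m G Q θ} := rfl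

lemma innerLP_OST_eq (k n m : ℕ) (G : ℕ → ℕ → ℝ) (J : ℕ) (ρ : ℝ) (Q : ℕ → ℝ) :
    innerLP_OST k n m G J ρ Q = sSup {θ | OSTfeas k n m G J ρ Q θ} := rfl

lemma OST_to_ST {k n m : ℕ} {G : ℕ → ℕ → ℝ} (hG : IsTypeDist n m G) {J : ℕ} {ρ : ℝ}
    (hJ : J ∈ Icc 1 m) (hρ : ρ ∈ Set.Ioc (0:ℝ) 1) {Q : ℕ → ℝ} {θ : ℝ}
    (h : OSTfeas k n m G J ρ Q θ) : STfeas k n m G Q θ := by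
  obtain ⟨x, y, hP, hy, hc⟩ := h
  have hτ := tau_bd hG hJ hρ.1.le hρ.2
  refine ⟨Measure.dirac (J, ρ), fun J ρ => Xs (tauOf G J ρ) k,
    fun J ρ i l => tauOf G J ρ i * Xs (tauOf G J ρ) k i l, inferInstance, ?_, ?_, ?_⟩
  · rw [Measure.dirac_apply]
    rw [Finset.mem_Icc] at hJ
    simp [hJ.1, hJ.2, hρ.1, hρ.2]
  · intro J hJ ρ hρ
    exact ⟨memP_Xs (tau_bd hG hJ hρ.1.le hρ.2) k, fun _ _ _ _ => rfl⟩
  · intro j hj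
    rw [integral_dirac]
    dsimp only
    rw [coverSum_eq hτ (memP_Xs hτ k) (fun _ _ _ _ => rfl), ← coverSum_eq hτ hP hy]
    exact hc j hj

lemma integral_le_of_supp {μ : Measure (ℕ × ℝ)} [IsProbabilityMeasure μ] {m : ℕ}
    (hμ : μ ((Set.Icc 1 m ×ˢ Set.Ioc (0:ℝ) 1)ᶜ) = 0) {f : ℕ × ℝ → ℝ} (hf : Integrable f μ) {C : ℝ}
    (h : ∀ J ∈ Icc 1 m, ∀ ρ ∈ Set.Ioc (0:ℝ) 1, f (J, ρ) ≤ C) : ∫ z, f z ∂μ ≤ C := by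
  have hae : ∀ᵐ z ∂μ, f z ≤ C := by
    have := measure_eq_zero_iff_ae_notMem.mp hμ
    filter_upwards [this] with z hz
    rw [Set.notMem_compl_iff] at hz
    obtain ⟨h1, h2⟩ := hz
    exact h z.1 (Finset.mem_Icc.mpr h1) z.2 h2
  have := integral_mono_ae hf (integrable_const C) hae
  simpa using this

lemma ST_bound {k n m : ℕ} (hk : 1 ≤ k) (hkn : k < n) (hm : 1 ≤ m) {G : ℕ → ℕ → ℝ}
    (hG : IsTypeDist n m G) {Q : ℕ → ℝ} (hQ : ∀ j ∈ Icc 1 m, QProph k n G j ≤ Q j) {θ : ℝ}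
    (h : STfeas k n m G Q θ) : θ ≤ 1 := by
  obtain ⟨μ, x, y, hμ, h0, hP, hc⟩ := h
  have hmm : m ∈ Icc 1 m := Finset.mem_Icc.mpr ⟨hm, le_rfl⟩
  have hkpos : (0:ℝ) < k := by exact_mod_cast hk
  have hQm := hQ m hmm
  rw [QProph_top hG hkn.le] at hQm
  have hcm := hc m hmm
  have hI : ∫ Jρ : ℕ × ℝ, coverSum k n G m (x Jρ.1 Jρ.2) (y Jρ.1 Jρ.2) ∂μ ≤ k := by
    by_cases hf : Integrable (fun Jρ : ℕ × ℝ => coverSum k n G m (x Jρ.1 Jρ.2) (y Jρ.1 Jρ.2)) μ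
    · refine integral_le_of_supp h0 hf ?_
      intro J hJ ρ hρ
      exact cover_le hG hJ hρ.1.le hρ.2 (hP J hJ ρ hρ).1 (hP J hJ ρ hρ).2 m
    · rw [integral_undef hf]; exact hkpos.le
  by_contra hlt
  push Not at hlt
  nlinarith

lemma ST_upper {k n : ℕ} (hk : 1 ≤ k) (hkn : k < n) {ρ v : ℝ}
    (hρ0 : 0 < ρ) (hρ1 : ρ < 1) (hv0 : 0 < v)
    (he : eS (Icc 1 (n - 1)) (fun _ => ρ) k = k * v)
    (hR : cS (Icc 1 (n - 1)) (fun _ => ρ) k = v) {ε : ℝ} (hε0 : 0 < ε) (hε1 : ε ≤ 1)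
    {Q : ℕ → ℝ} (hQ : ∀ j ∈ Icc 1 3, QProph k n (Gx n ε) j ≤ Q j) {θ : ℝ}
    (h : STfeas k n 3 (Gx n ε) Q θ) : θ ≤ v + ε := by
  by_contra hlt
  push Not at hlt
  have hθ : 0 < θ := by linarith
  have hkpos : (1:ℝ) ≤ k := by exact_mod_cast hk
  obtain ⟨μ, x, y, hμ, h0, hP, hc⟩ := h
  have m1 : 1 ∈ Icc 1 3 := by decide
  have m2 : 2 ∈ Icc 1 3 := by decide
  have c1 := hc 1 m1
  have c2 := hc 2 m2
  have q1 := hQ 1 m1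
  have q2 := hQ 2 m2
  rw [Gx_Q1 hk hkn] at q1
  have q2' := (Gx_Q2 hkn hε0.le hε1).trans q2
  have d1 : θ * ε ≤ _ := (mul_le_mul_of_nonneg_left q1 hθ.le).trans c1
  have d2 : θ * k ≤ _ := (mul_le_mul_of_nonneg_left q2' hθ.le).trans c2
  by_cases i1 : Integrable
    (fun Jρ : ℕ × ℝ => coverSum k n (Gx n ε) 1 (x Jρ.1 Jρ.2) (y Jρ.1 Jρ.2)) μ
  swap
  · rw [integral_undef i1] at d1
    nlinarith [mul_pos hθ hε0]
  by_cases i2 : Integrable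
    (fun Jρ : ℕ × ℝ => coverSum k n (Gx n ε) 2 (x Jρ.1 Jρ.2) (y Jρ.1 Jρ.2)) μ
  swap
  · rw [integral_undef i2] at d2
    nlinarith [mul_pos hθ (lt_of_lt_of_le one_pos hkpos)]
  have bρ : ∀ i ∈ Icc 1 (n - 1 - 1), 0 ≤ (fun _ : ℕ => ρ) i ∧ (fun _ : ℕ => ρ) i ≤ 1 :=
    fun _ _ => ⟨hρ0.le, hρ1.le⟩
  have hα : 0 < cS (Icc 1 (n - 1 - 1)) (fun _ => ρ) k := cS_pos (fun _ _ => ⟨hρ0.le, hρ1⟩) hk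
  have hβ : 0 ≤ cS (Icc 1 (n - 1 - 1)) (fun _ => ρ) k -
      cS (Icc 1 (n - 1 - 1)) (fun _ => ρ) (k - 1) :=
    sub_nonneg.mpr (cS_mono bρ (by omega))
  have tang := fun (σ : ℝ) (s0 : 0 ≤ σ) (s1 : σ ≤ 1) =>
    binom_tangent (n - 1) k (ρ := ρ) hρ0.le hρ1.le s0 s1
  rw [he, hR] at tang
  generalize cS (Icc 1 (n - 1 - 1)) (fun _ => ρ) k = α at *
  generalize α - cS (Icc 1 (n - 1 - 1)) (fun _ => ρ) (k - 1) = β at *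
  have hint := integral_le_of_supp h0 ((i1.const_mul α).add (i2.const_mul (β * ε)))
    (C := ε * (α * v + β * (k * v) + β * ε)) (by
      intro J hJ r hr
      obtain ⟨σ, s0, s1, b1, b2⟩ := Gx_cover hkn hJ hε0.le hε1 hr.1.le hr.2
        (hP J hJ r hr).1 (hP J hJ r hr).2
      have t := mul_le_mul_of_nonneg_left (tang σ s0 s1) hε0.le
      have t1 := mul_le_mul_of_nonneg_left b1 hα.le
      have t2 := mul_le_mul_of_nonneg_left b2 (mul_nonneg hβ hε0.le)
      simp only [Pi.add_apply]
      nlinarith)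
  rw [integral_add' (i1.const_mul α) (i2.const_mul (β * ε)), integral_const_mul,
    integral_const_mul] at hint
  have u1 := mul_le_mul_of_nonneg_left d1 hα.le
  have u2 := mul_le_mul_of_nonneg_left d2 (mul_nonneg hβ hε0.le)
  have u3 : ε * ((α + β * k) * θ) ≤ ε * (α * v + β * (k * v) + β * ε) := by linarith
  have u4 := le_of_mul_le_mul_left u3 hε0
  have u5 : 0 < α + β * k := by
    have : 0 ≤ β * k := mul_nonneg hβ (by linarith)
    linarith
  have u6 := mul_lt_mul_of_pos_left hlt u5
  have u7 : β * ε ≤ (α + β * k) * ε := by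
    refine mul_le_mul_of_nonneg_right ?_ hε0.le
    nlinarith
  nlinarith

/-- Existence of the crossing point. -/
lemma exists_crossing {k n : ℕ} (hk : 1 ≤ k) (hkn : k < n) :
    ∃ ρ v : ℝ, 0 < ρ ∧ ρ < 1 ∧ 0 < v ∧ v ≤ 1 ∧
      eS (Icc 1 (n - 1)) (fun _ => ρ) k = k * v ∧ cS (Icc 1 (n - 1)) (fun _ => ρ) k = v := by
  have hkpos : (0:ℝ) < k := by exact_mod_cast hk
  have e0 : eS (Icc 1 (n - 1)) (fun _ => (0:ℝ)) k = 0 := by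
    rw [eS, Ef_zero _ _ _ fun _ _ => rfl]; simp
  have r0 : cS (Icc 1 (n - 1)) (fun _ => (0:ℝ)) k = 1 := by
    rw [cS, Ef_zero _ _ _ fun _ _ => rfl, if_pos (by omega)]
  have e1 : eS (Icc 1 (n - 1)) (fun _ => (1:ℝ)) k = k := by
    rw [eS, Ef_one _ _ _ fun _ _ => rfl]
    have : (k:ℝ) ≤ (n - 1 : ℕ) := by exact_mod_cast (by omega : k ≤ n - 1)
    simp only [Nat.card_Icc, Nat.add_sub_cancel]
    rw [min_eq_right this]
  have r1 : cS (Icc 1 (n - 1)) (fun _ => (1:ℝ)) k = 0 := by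
    rw [cS, Ef_one _ _ _ fun _ _ => rfl]
    simp only [Nat.card_Icc, Nat.add_sub_cancel]
    rw [if_neg (by omega)]
  have hc : Continuous fun r : ℝ => eS (Icc 1 (n - 1)) (fun _ => r) k -
      k * cS (Icc 1 (n - 1)) (fun _ => r) k :=
    (Ef_continuous _ (fun r _ => r) (fun _ => continuous_id) _).sub
      (continuous_const.mul (Ef_continuous _ (fun r _ => r) (fun _ => continuous_id) _))
  obtain ⟨ρ, hρ, h⟩ := intermediate_value_Icc (zero_le_one' ℝ) hc.continuousOn
    (show (0:ℝ) ∈ Set.Icc _ _ from ⟨by rw [e0, r0]; linarith, by rw [e1, r1]; linarith⟩)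
  dsimp only at h
  have hρ0 : 0 < ρ := by
    rcases hρ.1.eq_or_lt with h' | h'
    · exfalso; rw [← h', e0, r0] at h; linarith
    · exact h'
  have hρ1 : ρ < 1 := by
    rcases hρ.2.eq_or_lt with h' | h'
    · exfalso; rw [h', e1, r1] at h; linarith
    · exact h'
  exact ⟨ρ, _, hρ0, hρ1, cS_pos (fun _ _ => ⟨hρ0.le, hρ1⟩) hk,
    cS_le_one (fun _ _ => ⟨hρ0.le, hρ1.le⟩) k, by linarith, rfl⟩

/-- An infimum computed from a lower bound and approximate attainment. -/
lemma sInf_eq_of_approx {s : Set ℝ} {v : ℝ} (h1 : ∀ w ∈ s, v ≤ w)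
    (h2 : ∀ ε : ℝ, 0 < ε → ε ≤ 1 → ∃ w ∈ s, w ≤ v + ε) : sInf s = v := by
  have hb : BddBelow s := ⟨v, h1⟩
  obtain ⟨w0, hw0, _⟩ := h2 1 one_pos le_rfl
  refine le_antisymm ?_ (le_csInf ⟨w0, hw0⟩ h1)
  refine le_of_forall_pos_le_add fun ε hε => ?_
  obtain ⟨w, hw, hle⟩ := h2 (min ε 1) (lt_min hε one_pos) (min_le_right _ _)
  have := csInf_le hb hw
  have := min_le_left ε 1
  linarith

lemma four_values {k n : ℕ} (hk : 1 ≤ k) (hkn : k < n) {ρ v : ℝ}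
    (hρ0 : 0 < ρ) (hρ1 : ρ < 1) (hv0 : 0 < v) (hv1 : v ≤ 1)
    (he : eS (Icc 1 (n - 1)) (fun _ => ρ) k = k * v)
    (hR : cS (Icc 1 (n - 1)) (fun _ => ρ) k = v)
    (Q : (ℕ → ℕ → ℝ) → ℕ → ℝ)
    (hQ : ∀ m G, IsTypeDist n m G → ∀ j ∈ Icc 1 m,
      QProph k n G j ≤ Q G j ∧ Q G j ≤ QExAnte k n G j) :
    sInf {w : ℝ | ∃ m, 1 ≤ m ∧ ∃ G, IsTypeDist n m G ∧ w = innerLP_ST k n m G (Q G)} = v ∧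
    sInf {u : ℝ | ∃ m, 1 ≤ m ∧ ∃ G, IsTypeDist n m G ∧
        u = sSup {w : ℝ | ∃ J ∈ Finset.Icc 1 m, ∃ ρ ∈ Set.Ioc (0:ℝ) 1,
          w = innerLP_OST k n m G J ρ (Q G)}} = v := by
  have low : ∀ m G, IsTypeDist n m G → ∃ J ∈ Icc 1 m, ∃ r ∈ Set.Ioc (0:ℝ) 1,
      OSTfeas k n m G J r (Q G) v := by
    intro m G hG
    obtain ⟨J, hJ, r, hr, x, y, h1, h2, h3⟩ :=
      lower_bound hk hkn hρ0 hρ1 hv0 hv1 he hR hG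
    exact ⟨J, hJ, r, hr, x, y, h1, h2, fun j hj =>
      (mul_le_mul_of_nonneg_left (hQ m G hG j hj).2 hv0.le).trans (h3 j hj)⟩
  have bd : ∀ m G, 1 ≤ m → IsTypeDist n m G → ∀ θ, STfeas k n m G (Q G) θ → θ ≤ 1 :=
    fun m G hm hG θ h => ST_bound hk hkn hm hG (fun j hj => (hQ m G hG j hj).1) h
  have up : ∀ ε : ℝ, 0 < ε → ε ≤ 1 → ∀ θ, STfeas k n 3 (Gx n ε) (Q (Gx n ε)) θ → θ ≤ v + ε :=
    fun ε h0 h1 θ h => ST_upper hk hkn hρ0 hρ1 hv0 he hR h0 h1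
      (fun j hj => (hQ 3 _ (Gx_typeDist n h0.le h1) j hj).1) h
  constructor
  · refine sInf_eq_of_approx ?_ ?_
    · rintro w ⟨m, hm, G, hG, rfl⟩
      obtain ⟨J, hJ, r, hr, hf⟩ := low m G hG
      rw [innerLP_ST_eq]
      exact le_csSup ⟨1, fun θ h => bd m G hm hG θ h⟩ (OST_to_ST hG hJ hr hf)
    · intro ε h0 h1
      refine ⟨_, ⟨3, by norm_num, Gx n ε, Gx_typeDist n h0.le h1, rfl⟩, ?_⟩
      rw [innerLP_ST_eq]
      exact Real.sSup_le (fun θ h => up ε h0 h1 θ h) (by linarith)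
  · refine sInf_eq_of_approx ?_ ?_
    · rintro w ⟨m, hm, G, hG, rfl⟩
      obtain ⟨J, hJ, r, hr, hf⟩ := low m G hG
      have h1 : v ≤ innerLP_OST k n m G J r (Q G) := by
        rw [innerLP_OST_eq]
        exact le_csSup ⟨1, fun θ h => bd m G hm hG θ (OST_to_ST hG hJ hr h)⟩ hf
      refine h1.trans (le_csSup ⟨1, ?_⟩ ⟨J, hJ, r, hr, rfl⟩)
      rintro _ ⟨J, hJ, r, hr, rfl⟩
      rw [innerLP_OST_eq]
      exact Real.sSup_le (fun θ h => bd m G hm hG θ (OST_to_ST hG hJ hr h)) zero_le_one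
    · intro ε h0 h1
      have hG := Gx_typeDist n h0.le h1
      refine ⟨_, ⟨3, by norm_num, Gx n ε, hG, rfl⟩, ?_⟩
      refine Real.sSup_le ?_ (by linarith)
      rintro _ ⟨J, hJ, r, hr, rfl⟩
      rw [innerLP_OST_eq]
      exact Real.sSup_le (fun θ h => up ε h0 h1 θ (OST_to_ST hG hJ hr h)) (by linarith)

/-- Theorem `STequalOST`: in the worst case over type distributions, the
four quantities `inf_G innerLP^{ST/Proph}`, `inf_G innerLP^{ST/ExAnte}`,
`inf_G sup_{J,ρ} innerLP^{OST(J,ρ)/Proph}`, and `inf_G sup_{J,ρ} innerLP^{OST(J,ρ)/ExAnte}`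
are all equal. -/
theorem stmt12 (k n : ℕ) (hk : 1 ≤ k) (hkn : k < n) :
    (sInf {v : ℝ | ∃ m, 1 ≤ m ∧ ∃ G, IsTypeDist n m G ∧
        v = innerLP_ST k n m G (QProph k n G)}
      = sInf {v : ℝ | ∃ m, 1 ≤ m ∧ ∃ G, IsTypeDist n m G ∧
          v = innerLP_ST k n m G (QExAnte k n G)}) ∧
    (sInf {v : ℝ | ∃ m, 1 ≤ m ∧ ∃ G, IsTypeDist n m G ∧
        v = innerLP_ST k n m G (QExAnte k n G)}
      = sInf {v : ℝ | ∃ m, 1 ≤ m ∧ ∃ G, IsTypeDist n m G ∧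
          v = sSup {w : ℝ | ∃ J ∈ Finset.Icc 1 m, ∃ ρ ∈ Set.Ioc (0:ℝ) 1,
            w = innerLP_OST k n m G J ρ (QProph k n G)}}) ∧
    (sInf {v : ℝ | ∃ m, 1 ≤ m ∧ ∃ G, IsTypeDist n m G ∧
        v = sSup {w : ℝ | ∃ J ∈ Finset.Icc 1 m, ∃ ρ ∈ Set.Ioc (0:ℝ) 1,
          w = innerLP_OST k n m G J ρ (QProph k n G)}}
      = sInf {v : ℝ | ∃ m, 1 ≤ m ∧ ∃ G, IsTypeDist n m G ∧
          v = sSup {w : ℝ | ∃ J ∈ Finset.Icc 1 m, ∃ ρ ∈ Set.Ioc (0:ℝ) 1,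
            w = innerLP_OST k n m G J ρ (QExAnte k n G)}}) := by
  obtain ⟨ρ, v, hρ0, hρ1, hv0, hv1, he, hR⟩ := exists_crossing hk hkn
  have A := four_values hk hkn hρ0 hρ1 hv0 hv1 he hR (fun G => QProph k n G)
    (fun m G hG j hj => ⟨le_rfl, QProph_le hG (Finset.mem_Icc.mp hj).2⟩)
  have B := four_values hk hkn hρ0 hρ1 hv0 hv1 he hR (fun G => QExAnte k n G)
    (fun m G hG j hj => ⟨QProph_le hG (Finset.mem_Icc.mp hj).2, le_rfl⟩)
  exact ⟨A.1.trans B.1.symm, B.1.trans A.2.symm, A.2.trans B.2.symm⟩
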